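/- Let Δ₀, Δ₁, …, Δ_s be a sequence of Delzant polygons in ℝ² such that, for each i, the polygon Δᵢ is obtained from Δᵢ₋₁ by a corner chopping of size δᵢ > 0. Then for every edge d of Δ₀, the rational length of d satisfies |d| ≤ 2^s · perimeter(Δ_s), where the perimeter of a polygon denotes the sum of the rational lengths of its edges. -/

import Mathlib

open Set Finset MeasureTheory

/-- Points of ℝⁿ. -/
abbrev Pt (n : ℕ) := Fin n → ℝ

/-- A convex polytope in ℝⁿ: a compact convex set with nonempty interior and
finitely many extreme points. -/
def IsConvexPolytope {n : ℕ} (Δ : Set (Pt n)) : Prop :=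
  IsCompact Δ ∧ Convex ℝ Δ ∧ (interior Δ).Nonempty ∧ (Set.extremePoints ℝ Δ).Finite

/-- An edge (one-dimensional face) of a polytope: a nondegenerate closed segment
that is an extreme subset of the polytope. -/
def IsEdge {n : ℕ} (Δ e : Set (Pt n)) : Prop :=
  (∃ a b : Pt n, a ≠ b ∧ e = segment ℝ a b) ∧ IsExtreme ℝ Δ e

/-- A family of vectors of ℝⁿ forming a basis of the lattice ℤⁿ. -/
def IsLatticeBasis {n : ℕ} (α : Fin n → Pt n) : Prop :=
  ∃ A : Matrix (Fin n) (Fin n) ℤ, IsUnit A.det ∧ ∀ j i, α j i = (A j i : ℝ)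

/-- The Delzant condition at the vertex `v`: the edges emanating from `v` have the
form `{v + s • α j : 0 ≤ s ≤ ℓ j}` where the `α j` form a basis of the lattice ℤⁿ. -/
def DelzantAt {n : ℕ} (Δ : Set (Pt n)) (v : Pt n) : Prop :=
  ∃ (α : Fin n → Pt n) (ℓ : Fin n → ℝ), IsLatticeBasis α ∧ (∀ j, 0 < ℓ j) ∧
    {e | IsEdge Δ e ∧ v ∈ e} = {e | ∃ j, e = segment ℝ v (v + ℓ j • α j)}

/-- A Delzant polytope in ℝⁿ. -/
def IsDelzant {n : ℕ} (Δ : Set (Pt n)) : Prop :=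
  IsConvexPolytope Δ ∧ ∀ v ∈ Set.extremePoints ℝ Δ, DelzantAt Δ v

/-- `Δ'` is obtained from `Δ` by a corner chopping of size `δ` at the vertex `v`. -/
def IsCornerChop {n : ℕ} (Δ : Set (Pt n)) (v : Pt n) (δ : ℝ) (Δ' : Set (Pt n)) : Prop :=
  v ∈ Set.extremePoints ℝ Δ ∧ 0 < δ ∧
  ∃ (α : Fin n → Pt n) (ℓ : Fin n → ℝ), IsLatticeBasis α ∧ (∀ j, δ < ℓ j) ∧
    {e | IsEdge Δ e ∧ v ∈ e} = {e | ∃ j, e = segment ℝ v (v + ℓ j • α j)} ∧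
    Δ' = Δ ∩ {x | ∃ s : Fin n → ℝ, x = v + ∑ j, s j • α j ∧ δ ≤ ∑ j, s j}

/-- An element of AGL(n,ℤ): an affine map `x ↦ A x + c` with `A ∈ GL(n,ℤ)`. -/
def IsAGL {n : ℕ} (g : Pt n → Pt n) : Prop :=
  ∃ (A : Matrix (Fin n) (Fin n) ℤ) (c : Pt n), IsUnit A.det ∧
    ∀ x, g x = (A.map (fun z : ℤ => (z : ℝ))).mulVec x + c

/-- Two subsets of ℝⁿ are AGL(n,ℤ)-congruent. -/
def AGLCongruent {n : ℕ} (S T : Set (Pt n)) : Prop :=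
  ∃ g : Pt n → Pt n, IsAGL g ∧ g '' S = T

/-- A primitive vector of ℤⁿ: nonzero and not a multiple `m • w` with `m ≥ 2`. -/
def IsPrimitive {n : ℕ} (v : Fin n → ℤ) : Prop :=
  v ≠ 0 ∧ ∀ m : ℕ, 2 ≤ m → ∀ w : Fin n → ℤ, v ≠ (m : ℤ) • w

/-- `d` is a segment of rational slope and rational length `ℓ`: its endpoints differ
by `ℓ • v` with `v` a primitive vector of ℤⁿ. -/
def RatLength {n : ℕ} (d : Set (Pt n)) (ℓ : ℝ) : Prop :=
  0 < ℓ ∧ ∃ (a : Pt n) (v : Fin n → ℤ), IsPrimitive v ∧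
    d = segment ℝ a (a + ℓ • fun i => (v i : ℝ))

/-- `P` is the (rational) perimeter of the polygon `Δ`: the sum of the rational
lengths of its edges. -/
def HasPerimeter (Δ : Set (Pt 2)) (P : ℝ) : Prop :=
  ∃ (E : Finset (Set (Pt 2))) (len : Set (Pt 2) → ℝ),
    (↑E = {e | IsEdge Δ e}) ∧ (∀ e ∈ E, RatLength e (len e)) ∧ P = ∑ e ∈ E, len e

/-- The Delzant triangle of size `lam`. -/
def DelzantTriangle (lam : ℝ) : Set (Pt 2) :=
  {x | 0 ≤ x 0 ∧ 0 ≤ x 1 ∧ x 0 + x 1 ≤ lam}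

/-- The Hirzebruch trapezoid with parameters `a`, `b`, `k`. -/
def Hirz (a b : ℝ) (k : ℕ) : Set (Pt 2) :=
  {x | -(b/2) ≤ x 1 ∧ x 1 ≤ b/2 ∧ 0 ≤ x 0 ∧ x 0 ≤ a - k * x 1}

/-- A segment with endpoints in another segment is no longer in any coordinate. -/
lemma abs_coord_sub_le_of_mem_segment {n : ℕ} {a b c d : Pt n}
    (ha : a ∈ segment ℝ c d) (hb : b ∈ segment ℝ c d) (i : Fin n) :
    |b i - a i| ≤ |d i - c i| := by
  obtain ⟨s, hs, rfl⟩ := (segment_eq_image' ℝ c d).subset ha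
  obtain ⟨t, ht, rfl⟩ := (segment_eq_image' ℝ c d).subset hb
  have h : (c + t • (d - c)) i - (c + s • (d - c)) i = (t - s) * (d i - c i) := by
    simp only [Pi.add_apply, Pi.smul_apply, Pi.sub_apply, smul_eq_mul]; ring
  rw [h, abs_mul]
  have h1 : |t - s| ≤ 1 := by
    rw [abs_le]; constructor <;> linarith [hs.1, hs.2, ht.1, ht.2]
  exact mul_le_of_le_one_left (abs_nonneg _) h1

lemma abs_coord_sub_eq_of_segment_eq {n : ℕ} {a b c d : Pt n}
    (h : segment ℝ a b = segment ℝ c d) (i : Fin n) : |b i - a i| = |d i - c i| :=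
  le_antisymm
    (abs_coord_sub_le_of_mem_segment (h ▸ left_mem_segment ℝ a b) (h ▸ right_mem_segment ℝ a b) i)
    (abs_coord_sub_le_of_mem_segment (h.symm ▸ left_mem_segment ℝ c d)
      (h.symm ▸ right_mem_segment ℝ c d) i)

lemma IsPrimitive.coprime {v : Fin 2 → ℤ} (hv : IsPrimitive v) :
    Nat.Coprime (v 0).natAbs (v 1).natAbs := by
  by_contra hg
  set g := Nat.gcd (v 0).natAbs (v 1).natAbs with hgdef
  have hg0 : g ≠ 0 := by
    intro h0
    rw [hgdef, Nat.gcd_eq_zero_iff, Int.natAbs_eq_zero, Int.natAbs_eq_zero] at h0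
    exact hv.1 (by ext i; fin_cases i <;> simp [h0])
  have hg2 : 2 ≤ g := by
    have : g ≠ 1 := hg
    omega
  obtain ⟨x, hx⟩ := Int.natCast_dvd.2 (Nat.gcd_dvd_left (v 0).natAbs (v 1).natAbs)
  obtain ⟨y, hy⟩ := Int.natCast_dvd.2 (Nat.gcd_dvd_right (v 0).natAbs (v 1).natAbs)
  refine hv.2 g hg2 ![x, y] ?_
  ext i
  fin_cases i
  · simpa using hx
  · simpa using hy

lemma isPrimitive_of_isUnit {v : Fin 2 → ℤ} (c d : ℤ) (h : IsUnit (v 0 * d - v 1 * c)) :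
    IsPrimitive v := by
  refine ⟨fun h0 => by simp [h0] at h, fun m hm w hw => ?_⟩
  have hdvd : (m : ℤ) ∣ v 0 * d - v 1 * c :=
    ⟨w 0 * d - w 1 * c, by simp only [hw, Pi.smul_apply, smul_eq_mul]; ring⟩
  have hu : IsUnit (m : ℤ) := isUnit_of_dvd_unit hdvd h
  rw [Int.isUnit_iff] at hu
  omega

lemma RatLength.unique {d : Set (Pt 2)} {l m : ℝ} (hl : RatLength d l) (hm : RatLength d m) :
    l = m := by
  obtain ⟨l0, a, v, hv, rfl⟩ := hl
  obtain ⟨m0, b, w, hw, h⟩ := hm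
  have key : ∀ i, l * ((v i).natAbs : ℝ) = m * ((w i).natAbs : ℝ) := by
    intro i
    have := abs_coord_sub_eq_of_segment_eq h i
    simpa [abs_mul, abs_of_pos l0, abs_of_pos m0, Nat.cast_natAbs] using this
  have cv := hv.coprime
  have cw := hw.coprime
  have cross : (v 0).natAbs * (w 1).natAbs = (w 0).natAbs * (v 1).natAbs := by
    have h0 := key 0
    have h1 := key 1
    have : l * (((v 0).natAbs : ℝ) * (w 1).natAbs) = l * ((w 0).natAbs * (v 1).natAbs) := by
      linear_combination ((w 1).natAbs : ℝ) * h0 - ((w 0).natAbs : ℝ) * h1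
    exact_mod_cast mul_left_cancel₀ l0.ne' this
  have e0 : (v 0).natAbs = (w 0).natAbs := Nat.dvd_antisymm
    (cv.dvd_of_dvd_mul_right (Dvd.intro _ cross))
    (cw.dvd_of_dvd_mul_right (Dvd.intro _ cross.symm))
  have e1 : (v 1).natAbs = (w 1).natAbs := Nat.dvd_antisymm
    (cv.symm.dvd_of_dvd_mul_left (Dvd.intro_left _ cross.symm))
    (cw.symm.dvd_of_dvd_mul_left (Dvd.intro_left _ cross))
  by_cases hz : (v 0).natAbs = 0
  · have h1 : (v 1).natAbs = 1 := by simpa [hz] using cv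
    have := key 1
    rw [← e1, h1] at this
    simpa using this
  · have := key 0
    rw [← e0] at this
    exact mul_right_cancel₀ (Nat.cast_ne_zero.2 hz) this

open Classical in
/-- The rational length of `d`, or `0` if `d` is not a segment of rational slope. -/
noncomputable def ratLen (d : Set (Pt 2)) : ℝ :=
  if h : ∃ l, RatLength d l then h.choose else 0

lemma RatLength.ratLen_eq {d : Set (Pt 2)} {l : ℝ} (h : RatLength d l) : ratLen d = l := by
  have hex : ∃ l, RatLength d l := ⟨l, h⟩
  rw [ratLen, dif_pos hex]
  exact hex.choose_spec.unique h

lemma ratLen_nonneg (d : Set (Pt 2)) : 0 ≤ ratLen d := by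
  unfold ratLen
  split_ifs with h
  · exact h.choose_spec.1.le
  · exact le_rfl

/-- Every finite family of rational edges of `Δ` has total rational length at most `P`. -/
def PerimeterLE (Δ : Set (Pt 2)) (P : ℝ) : Prop :=
  ∀ E : Finset (Set (Pt 2)), (∀ e ∈ E, IsEdge Δ e ∧ ∃ l, RatLength e l) → ∑ e ∈ E, ratLen e ≤ P

lemma HasPerimeter.perimeterLE {Δ : Set (Pt 2)} {P : ℝ} (h : HasPerimeter Δ P) :
    PerimeterLE Δ P := by
  obtain ⟨F, len, hF, hlen, rfl⟩ := h
  intro E hE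
  have hsub : E ⊆ F := fun e he => by
    have : e ∈ (F : Set (Set (Pt 2))) := hF ▸ (hE e he).1
    exact this
  calc ∑ e ∈ E, ratLen e ≤ ∑ e ∈ F, ratLen e :=
        Finset.sum_le_sum_of_subset_of_nonneg hsub fun e _ _ => ratLen_nonneg e
    _ = ∑ e ∈ F, len e := Finset.sum_congr rfl fun e he => (hlen e he).ratLen_eq

/-- A convex set with an extreme segment from an extreme point `v` in direction `a`, and a point
on the ray from `v` in direction `b`, lies on one side of the line spanned by the segment. -/
lemma nonneg_coord_of_isExtreme {V : Type*} [AddCommGroup V] [Module ℝ V] {Δ : Set V} {v a b : V}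
    {l m : ℝ} {f g : V →ₗ[ℝ] ℝ} (hΔ : Convex ℝ Δ) (hv : v ∈ Set.extremePoints ℝ Δ)
    (hl : 0 < l) (hm : 0 < m) (he : IsExtreme ℝ Δ (segment ℝ v (v + l • a)))
    (hb : v + m • b ∈ Δ) (hfa : f a = 1) (hga : g a = 0)
    (hgb : g b = 1) (hfg : ∀ x, x = f x • a + g x • b) {x : V} (hx : x ∈ Δ) :
    0 ≤ g (x - v) := by
  by_contra! hneg
  have hmem : ∀ y ∈ segment ℝ v (v + l • a), g (y - v) = 0 := by
    intro y hy
    obtain ⟨s, -, rfl⟩ := (segment_eq_image' ℝ v (v + l • a)).subset hy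
    simp [hga]
  have hxe : x ∉ segment ℝ v (v + l • a) := fun h => hneg.ne (hmem x h)
  set r := -g (x - v) with hr
  have hr0 : 0 < r := by linarith
  set y : V := (m / (m + r)) • x + (r / (m + r)) • (v + m • b) with hy
  have hy_open : y ∈ openSegment ℝ x (v + m • b) :=
    ⟨_, _, by positivity, by positivity, by field_simp, rfl⟩
  have hyΔ : y ∈ Δ := hΔ.openSegment_subset hx hb hy_open
  have hgy : g (y - v) = 0 := by
    have : y - v = (m / (m + r)) • (x - v) + (r / (m + r)) • (m • b) := by
      have h1 : r / (m + r) = 1 - m / (m + r) := by field_simp; ring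
      rw [hy, h1]; module
    rw [this]
    have hgx : g (x - v) = -r := by linarith
    simp only [map_add, map_smul, hgx, hgb, smul_eq_mul]
    field_simp
    ring
  set t := f (y - v) with ht
  have hyt : y = v + t • a := by
    have := hfg (y - v)
    rw [hgy, zero_smul, add_zero, ← ht] at this
    rw [← this]; abel
  have hva : v + l • a ∈ Δ := he.1 (right_mem_segment ℝ _ _)
  have hf_seg : ∀ z ∈ segment ℝ v (v + l • a), 0 ≤ f (z - v) ∧ f (z - v) ≤ l := by
    intro z hz
    obtain ⟨s, hs, rfl⟩ := (segment_eq_image' ℝ v (v + l • a)).subset hz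
    have : f (v + s • (v + l • a - v) - v) = s * l := by simp [hfa]
    rw [this]
    exact ⟨mul_nonneg hs.1 hl.le, mul_le_of_le_one_left hl.le hs.2⟩
  rcases lt_or_ge t 0 with ht0 | ht0
  · have hvo : v ∈ openSegment ℝ y (v + l • a) := by
      refine ⟨l / (l - t), -t / (l - t), div_pos hl (by linarith),
        div_pos (by linarith) (by linarith), ?_, ?_⟩
      · have : l - t ≠ 0 := by linarith
        field_simp; ring
      · have h1 : l - t ≠ 0 := by linarith
        have h2 : l / (l - t) = 1 - -t / (l - t) := by field_simp; ring
        have h3 : l / (l - t) * t + -t / (l - t) * l = 0 := by field_simp; ring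
        calc (l / (l - t)) • y + (-t / (l - t)) • (v + l • a)
            = (l / (l - t) + -t / (l - t)) • v
              + (l / (l - t) * t + -t / (l - t) * l) • a := by rw [hyt]; module
          _ = v := by rw [h3, h2]; simp
    have hyv : y = v := hv.2 hyΔ hva hvo
    have : t = 0 := by rw [ht, hyv]; simp
    linarith
  rcases le_or_gt t l with htl | htl
  · have hys : y ∈ segment ℝ v (v + l • a) := by
      rw [segment_eq_image']
      refine ⟨t / l, ⟨by positivity, (div_le_one hl).2 htl⟩, ?_⟩
      simp only [hyt, add_sub_cancel_left]
      rw [smul_smul, div_mul_cancel₀ _ hl.ne']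
    exact hxe (he.2 hx hb hys hy_open)
  · have hto : v + l • a ∈ openSegment ℝ y v := by
      have ht0' : 0 < t := hl.trans htl
      refine ⟨l / t, 1 - l / t, by positivity, by rw [sub_pos, div_lt_one ht0']; exact htl,
        by ring, ?_⟩
      have h3 : l / t * t = l := div_mul_cancel₀ _ ht0'.ne'
      calc (l / t) • y + (1 - l / t) • v = v + (l / t * t) • a := by rw [hyt]; module
        _ = v + l • a := by rw [h3]
    have hys := he.2 hyΔ (he.1 (left_mem_segment ℝ _ _)) (right_mem_segment ℝ _ _) hto
    have := (hf_seg y hys).2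
    linarith

lemma IsExtreme.inter_right {V : Type*} [AddCommGroup V] [Module ℝ V] {A B : Set V}
    (h : IsExtreme ℝ A B) (H : Set V) : IsExtreme ℝ (A ∩ H) (B ∩ H) :=
  ⟨Set.inter_subset_inter_left _ h.1, fun _ hx _ hy _ hz ho => ⟨h.2 hx.1 hy.1 hz.1 ho, hx.2⟩⟩

/-- If a point of an extreme subset `e` lies in the interior of a segment of `Δ` starting at `v`,
then `v ∈ e`. -/
lemma IsExtreme.mem_of_ray {V : Type*} [AddCommGroup V] [Module ℝ V] {Δ e : Set V}
    (he : IsExtreme ℝ Δ e) {v w : V} {s t : ℝ} (hv : v ∈ Δ) (hs : 0 < s) (hst : s < t)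
    (ht : v + t • w ∈ Δ) (hmem : v + s • w ∈ e) : v ∈ e := by
  have ht0 : 0 < t := hs.trans hst
  refine he.2 hv ht hmem ⟨1 - s / t, s / t, by rw [sub_pos, div_lt_one ht0]; exact hst,
    by positivity, by ring, ?_⟩
  have h3 : s / t * t = s := div_mul_cancel₀ _ ht0.ne'
  calc (1 - s / t) • v + (s / t) • (v + t • w) = v + (s / t * t) • w := by module
    _ = v + s • w := by rw [h3]

/-- The coordinate functionals of a lattice basis of the plane. -/
lemma IsLatticeBasis.exists_dual {α : Fin 2 → Pt 2} (h : IsLatticeBasis α) :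
    ∃ f g : Pt 2 →ₗ[ℝ] ℝ, f (α 0) = 1 ∧ f (α 1) = 0 ∧ g (α 0) = 0 ∧ g (α 1) = 1 ∧
      ∀ x, x = f x • α 0 + g x • α 1 := by
  obtain ⟨A, hA, hα⟩ := h
  rw [Matrix.det_fin_two, Int.isUnit_iff] at hA
  set D : ℝ := A 0 0 * A 1 1 - A 0 1 * A 1 0 with hD
  have hDD : D * D = 1 := by
    rcases hA with hA | hA
    · have : D = 1 := by rw [hD]; exact_mod_cast hA
      rw [this]; norm_num
    · have : D = -1 := by rw [hD]; exact_mod_cast hA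
      rw [this]; norm_num
  refine ⟨D • ((A 1 1 : ℝ) • LinearMap.proj 0 - (A 1 0 : ℝ) • LinearMap.proj 1),
    D • ((A 0 0 : ℝ) • LinearMap.proj 1 - (A 0 1 : ℝ) • LinearMap.proj 0), ?_, ?_, ?_, ?_, ?_⟩
  · simp [hα]; linear_combination hDD
  · simp [hα]; right; ring
  · simp [hα]; right; ring
  · simp [hα]; linear_combination hDD
  · intro x
    ext i
    fin_cases i
    · simp [hα]; linear_combination (-x 0) * hDD
    · simp [hα]; linear_combination (-x 1) * hDD

lemma IsLatticeBasis.exists_isPrimitive {α : Fin 2 → Pt 2} (h : IsLatticeBasis α) :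
    ∃ u v : Fin 2 → ℤ, IsPrimitive u ∧ IsPrimitive v ∧ IsPrimitive (v - u) ∧
      α 0 = (fun i => (u i : ℝ)) ∧ α 1 = (fun i => (v i : ℝ)) := by
  obtain ⟨A, hA, hα⟩ := h
  rw [Matrix.det_fin_two] at hA
  refine ⟨A 0, A 1, isPrimitive_of_isUnit (A 1 0) (A 1 1) hA,
    isPrimitive_of_isUnit (-A 0 0) (-A 0 1) ?_, isPrimitive_of_isUnit (-A 0 0) (-A 0 1) ?_,
    funext (hα 0), funext (hα 1)⟩
  · convert hA using 1; ring
  · convert hA using 1; simp only [Pi.sub_apply]; ring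

lemma segment_inter_halfspace {V : Type*} [AddCommGroup V] [Module ℝ V] {v a : V} {l δ : ℝ}
    {f : V →ₗ[ℝ] ℝ} (hδ : 0 < δ) (hl : δ < l) (hf : f a = 1) :
    segment ℝ v (v + l • a) ∩ {x | δ ≤ f (x - v)} = segment ℝ (v + δ • a) (v + l • a) := by
  have hl0 : 0 < l := hδ.trans hl
  ext x
  rw [segment_eq_image', segment_eq_image']
  constructor
  · rintro ⟨⟨t, ht, rfl⟩, hx⟩
    have hx' : δ ≤ t * l := by simpa [hf] using hx
    have hd : 0 < l - δ := by linarith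
    refine ⟨(t * l - δ) / (l - δ), ⟨div_nonneg (by linarith) hd.le, (div_le_one hd).2 ?_⟩, ?_⟩
    · nlinarith [ht.2]
    · have h3 : (t * l - δ) / (l - δ) * (l - δ) = t * l - δ := div_mul_cancel₀ _ hd.ne'
      calc v + δ • a + ((t * l - δ) / (l - δ)) • (v + l • a - (v + δ • a))
          = v + (δ + (t * l - δ) / (l - δ) * (l - δ)) • a := by module
        _ = v + t • (v + l • a - v) := by rw [h3]; module
  · rintro ⟨t, ht, rfl⟩
    have hd : 0 ≤ t * (l - δ) := mul_nonneg ht.1 (by linarith)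
    refine ⟨⟨(δ + t * (l - δ)) / l, ⟨by positivity, (div_le_one hl0).2 ?_⟩, ?_⟩, ?_⟩
    · nlinarith [ht.2]
    · have h3 : (δ + t * (l - δ)) / l * l = δ + t * (l - δ) := div_mul_cancel₀ _ hl0.ne'
      calc v + ((δ + t * (l - δ)) / l) • (v + l • a - v)
          = v + ((δ + t * (l - δ)) / l * l) • a := by module
        _ = v + δ • a + t • (v + l • a - (v + δ • a)) := by rw [h3]; module
    · have : v + δ • a + t • (v + l • a - (v + δ • a)) - v = (δ + t * (l - δ)) • a := by module
      simp only [Set.mem_ofPred_eq, this, map_smul, hf, smul_eq_mul]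
      linarith

/-- A corner chopping at most halves the perimeter. The edges away from the chopped vertex survive,
the two edges at it are shortened by `δ`, and a new edge of length `δ` appears. -/
lemma IsCornerChop.perimeterLE {Δ Δ' : Set (Pt 2)} {v : Pt 2} {δ P : ℝ} (hΔ : Convex ℝ Δ)
    (h : IsCornerChop Δ v δ Δ') (hP : PerimeterLE Δ' P) : PerimeterLE Δ (2 * P) := by
  classical
  obtain ⟨hv, hδ, α, l, hα, hl, hedges, rfl⟩ := h
  obtain ⟨f, g, hf0, hf1, hg0, hg1, hfg⟩ := hα.exists_dual
  obtain ⟨p, q, hp, hq, hqp, hαp, hαq⟩ := hα.exists_isPrimitive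
  set a := α 0
  set b := α 1
  have hH : {x : Pt 2 | ∃ s : Fin 2 → ℝ, x = v + ∑ j, s j • α j ∧ δ ≤ ∑ j, s j}
      = {x | δ ≤ (f + g) (x - v)} := by
    ext x
    simp only [Set.mem_ofPred_eq, Fin.sum_univ_two]
    constructor
    · rintro ⟨s, rfl, hs⟩
      simpa [a, b, hf0, hf1, hg0, hg1] using hs
    · intro hx
      refine ⟨![f (x - v), g (x - v)], ?_, by simpa using hx⟩
      have := hfg (x - v)
      simp only [Matrix.cons_val_zero, Matrix.cons_val_one]
      rw [← this]; abel
  rw [hH] at hP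
  set H : Set (Pt 2) := {x | δ ≤ (f + g) (x - v)} with hHdef
  have hfga : (f + g) a = 1 := by simp [hf0, hg0]
  have hfgb : (f + g) b = 1 := by simp [hf1, hg1]
  have hl0 := hl 0
  have hl1 := hl 1
  have pos0 : 0 < l 0 := hδ.trans hl0
  have pos1 : 0 < l 1 := hδ.trans hl1
  set ea := segment ℝ v (v + l 0 • a) with hea
  set eb := segment ℝ v (v + l 1 • b) with heb
  have hmem : ∀ e, IsEdge Δ e ∧ v ∈ e ↔ e = ea ∨ e = eb := by
    intro e
    have : e ∈ {e | IsEdge Δ e ∧ v ∈ e} ↔ e ∈ {e | ∃ j, e = segment ℝ v (v + l j • α j)} := by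
      rw [hedges]
    simpa [Fin.exists_fin_two] using this
  have hEa : IsExtreme ℝ Δ ea := ((hmem ea).2 (Or.inl rfl)).1.2
  have hEb : IsExtreme ℝ Δ eb := ((hmem eb).2 (Or.inr rfl)).1.2
  have hvΔ : v ∈ Δ := hv.1
  have haΔ : v + l 0 • a ∈ Δ := hEa.1 (right_mem_segment ℝ _ _)
  have hbΔ : v + l 1 • b ∈ Δ := hEb.1 (right_mem_segment ℝ _ _)
  have hgnn : ∀ x ∈ Δ, 0 ≤ g (x - v) := fun x hx =>
    nonneg_coord_of_isExtreme hΔ hv pos0 pos1 hEa hbΔ hf0 hg0 hg1 hfg hx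
  have hfnn : ∀ x ∈ Δ, 0 ≤ f (x - v) := fun x hx =>
    nonneg_coord_of_isExtreme hΔ hv pos1 pos0 hEb haΔ hg1 hf1 hf0
      (fun x => (hfg x).trans (add_comm _ _)) hx
  have hInterA : ea ∩ H = segment ℝ (v + δ • a) (v + l 0 • a) :=
    segment_inter_halfspace hδ hl0 hfga
  have hInterB : eb ∩ H = segment ℝ (v + δ • b) (v + l 1 • b) :=
    segment_inter_halfspace hδ hl1 hfgb
  have hpaA : v + δ • a ∈ ea ∩ H := hInterA ▸ left_mem_segment ℝ _ _
  have hpbB : v + δ • b ∈ eb ∩ H := hInterB ▸ left_mem_segment ℝ _ _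
  have hpaΔ : v + δ • a ∈ Δ := hEa.1 hpaA.1
  have hpbΔ : v + δ • b ∈ Δ := hEb.1 hpbB.1
  have hpbA : v + δ • b ∉ ea := by
    intro h
    obtain ⟨s, -, hs⟩ := (segment_eq_image' ℝ v (v + l 0 • a)).subset h
    have := congrArg (fun z => g (z - v)) hs
    simp [hg0, hg1] at this
    exact hδ.ne this
  have hpaB : v + δ • a ∉ eb := by
    intro h
    obtain ⟨s, -, hs⟩ := (segment_eq_image' ℝ v (v + l 1 • b)).subset h
    have := congrArg (fun z => f (z - v)) hs
    simp [hf0, hf1] at this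
    exact hδ.ne this
  set n := segment ℝ (v + δ • a) (v + δ • b) with hn
  have htri : ∀ x ∈ Δ, (f + g) (x - v) = δ → x ∈ n := by
    intro x hx hxδ
    have h1 := hfnn x hx
    have h2 := hgnn x hx
    rw [LinearMap.add_apply] at hxδ
    rw [hn, segment_eq_image']
    refine ⟨g (x - v) / δ, ⟨by positivity, (div_le_one hδ).2 (by linarith)⟩, ?_⟩
    have h3 : g (x - v) / δ * δ = g (x - v) := div_mul_cancel₀ _ hδ.ne'
    calc v + δ • a + (g (x - v) / δ) • (v + δ • b - (v + δ • a))
        = v + ((δ - g (x - v) / δ * δ) • a + (g (x - v) / δ * δ) • b) := by module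
      _ = v + (f (x - v) • a + g (x - v) • b) := by
          rw [h3, show δ - g (x - v) = f (x - v) by linarith]
      _ = x := by rw [← hfg (x - v)]; abel
  have hnf : ∀ x ∈ n, (f + g) (x - v) = δ := by
    intro x hx
    obtain ⟨s, -, rfl⟩ := (segment_eq_image' ℝ (v + δ • a) (v + δ • b)).subset hx
    have : v + δ • a + s • (v + δ • b - (v + δ • a)) - v = (δ - s * δ) • a + (s * δ) • b := by
      module
    rw [this, map_add, map_smul, map_smul, hfga, hfgb]
    simp
  have hnΔ : n ⊆ Δ := hΔ.segment_subset hpaΔ hpbΔ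
  have hnext : IsExtreme ℝ (Δ ∩ H) n := by
    refine ⟨fun x hx => ⟨hnΔ hx, (hnf x hx).ge⟩, ?_⟩
    rintro x ⟨hx, hxH⟩ y ⟨hy, hyH⟩ z hz ⟨s, t, hs, ht, hst, rfl⟩
    refine htri x hx ?_
    have h1 := hnf _ hz
    have h2 : s • x + t • y - v = s • (x - v) + t • (y - v) := by
      rw [show t = 1 - s by linarith]; module
    rw [h2, map_add, map_smul, map_smul, smul_eq_mul, smul_eq_mul] at h1
    rw [hHdef, Set.mem_ofPred_eq] at hxH hyH
    by_contra hne
    have hlt : δ < (f + g) (x - v) := lt_of_le_of_ne hxH (Ne.symm hne)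
    nlinarith [mul_lt_mul_of_pos_left hlt hs, mul_le_mul_of_nonneg_left hyH ht.le]
  -- Edges missing the chopped vertex survive.
  have hfar : ∀ e, IsExtreme ℝ Δ e → v ∉ e → e ⊆ H := by
    intro e he hve x hxe
    by_contra hxH
    rw [hHdef, Set.mem_ofPred_eq, not_le] at hxH
    have hx := he.1 hxe
    have h1 := hfnn x hx
    have h2 := hgnn x hx
    set r := (f + g) (x - v) with hr
    have hr' : r = f (x - v) + g (x - v) := rfl
    rcases (add_nonneg h1 h2).eq_or_lt with h0 | h0
    · apply hve
      have e1 : f (x - v) = 0 := by linarith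
      have e2 : g (x - v) = 0 := by linarith
      have := hfg (x - v)
      rw [e1, e2, zero_smul, zero_smul, add_zero, sub_eq_zero] at this
      exact this ▸ hxe
    · have hr0 : 0 < r := hr' ▸ h0
      refine hve (he.mem_of_ray (w := x - v) (s := 1) (t := δ / r) hvΔ one_pos
        ((one_lt_div hr0).2 hxH) ?_ (by simpa using hxe))
      refine hΔ.segment_subset hpaΔ hpbΔ ⟨f (x - v) / r, g (x - v) / r, by positivity,
        by positivity, by rw [← add_div, ← hr', div_self hr0.ne'], ?_⟩
      have h4 : f (x - v) / r + g (x - v) / r = 1 := by rw [← add_div, ← hr', div_self hr0.ne']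
      calc (f (x - v) / r) • (v + δ • a) + (g (x - v) / r) • (v + δ • b)
          = (f (x - v) / r + g (x - v) / r) • v
            + (δ / r) • (f (x - v) • a + g (x - v) • b) := by
              simp only [div_eq_mul_inv]; module
        _ = v + (δ / r) • (x - v) := by rw [h4, one_smul, ← hfg (x - v)]
  have hpa_far : ∀ e, IsExtreme ℝ Δ e → v ∉ e → v + δ • a ∉ e := fun e he hve h =>
    hve (he.mem_of_ray hvΔ hδ hl0 haΔ h)
  have hpb_far : ∀ e, IsExtreme ℝ Δ e → v ∉ e → v + δ • b ∉ e := fun e he hve h =>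
    hve (he.mem_of_ray hvΔ hδ hl1 hbΔ h)
  have ne_of_smul : ∀ (s t : ℝ) (w : Pt 2) (k : Pt 2 →ₗ[ℝ] ℝ), k w = 1 → s < t →
      v + s • w ≠ v + t • w := by
    intro s t w k hk hst h
    have := congrArg k h
    simp [hk] at this
    exact hst.ne this
  have edgeA : IsEdge (Δ ∩ H) (ea ∩ H) :=
    ⟨⟨_, _, ne_of_smul _ _ _ _ hf0 hl0, hInterA⟩, hEa.inter_right H⟩
  have edgeB : IsEdge (Δ ∩ H) (eb ∩ H) :=
    ⟨⟨_, _, ne_of_smul _ _ _ _ hg1 hl1, hInterB⟩, hEb.inter_right H⟩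
  have hab : v + δ • a ≠ v + δ • b := fun h => hpaB (h ▸ hpbB.1)
  have edgeN : IsEdge (Δ ∩ H) n := ⟨⟨_, _, hab, hn⟩, hnext⟩
  have lenA : RatLength ea (l 0) := ⟨pos0, v, p, hp, by rw [hea, hαp]⟩
  have lenB : RatLength eb (l 1) := ⟨pos1, v, q, hq, by rw [heb, hαq]⟩
  have lenA' : RatLength (ea ∩ H) (l 0 - δ) := by
    refine ⟨by linarith, v + δ • a, p, hp, ?_⟩
    rw [hInterA, ← hαp]; congr 1; module
  have lenB' : RatLength (eb ∩ H) (l 1 - δ) := by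
    refine ⟨by linarith, v + δ • b, q, hq, ?_⟩
    rw [hInterB, ← hαq]; congr 1; module
  have lenN : RatLength n δ := by
    refine ⟨hδ, v + δ • a, q - p, hqp, ?_⟩
    have : (fun i => (((q - p) i : ℤ) : ℝ)) = b - a := by
      rw [hαp, hαq]; ext i; simp
    rw [hn, this]; congr 1; module
  intro E hE
  set F := E.filter (fun e => v ∉ e) with hF
  have hFE : ∀ e ∈ F, IsEdge Δ e ∧ v ∉ e ∧ ∃ m, RatLength e m := fun e he =>
    ⟨(hE e (Finset.mem_filter.1 he).1).1, (Finset.mem_filter.1 he).2,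
      (hE e (Finset.mem_filter.1 he).1).2⟩
  have hnear : ∑ e ∈ E.filter (fun e => ¬ v ∉ e), ratLen e ≤ l 0 + l 1 := by
    have hne : ea ≠ eb := fun h => hpaB (h ▸ hpaA.1)
    rw [← lenA.ratLen_eq, ← lenB.ratLen_eq, ← Finset.sum_pair hne]
    refine Finset.sum_le_sum_of_subset_of_nonneg (fun e he => ?_) fun e _ _ => ratLen_nonneg e
    obtain ⟨he1, he2⟩ := Finset.mem_filter.1 he
    simpa using (hmem e).1 ⟨(hE e he1).1, not_not.1 he2⟩
  have hsplit := Finset.sum_filter_add_sum_filter_not E (fun e => v ∉ e) ratLen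
  have nN : n ∉ F := fun h =>
    hpa_far n (hFE n h).1.2 (hFE n h).2.1 (left_mem_segment ℝ _ _)
  have nB : eb ∩ H ∉ insert n F := by
    rw [Finset.mem_insert, not_or]
    refine ⟨fun h => hpaB ?_, fun h => hpb_far _ (hFE _ h).1.2 (hFE _ h).2.1 hpbB⟩
    have : v + δ • a ∈ eb ∩ H := h ▸ left_mem_segment ℝ _ _
    exact this.1
  have nA : ea ∩ H ∉ insert (eb ∩ H) (insert n F) := by
    rw [Finset.mem_insert, Finset.mem_insert, not_or, not_or]
    refine ⟨fun h => hpaB ?_, fun h => hpbA ?_,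
      fun h => hpa_far _ (hFE _ h).1.2 (hFE _ h).2.1 hpaA⟩
    · have : v + δ • a ∈ eb ∩ H := h ▸ hpaA
      exact this.1
    · have : v + δ • b ∈ ea ∩ H := h ▸ right_mem_segment ℝ _ _
      exact this.1
  have hmain := hP (insert (ea ∩ H) (insert (eb ∩ H) (insert n F))) (by
    intro e he
    simp only [Finset.mem_insert] at he
    rcases he with rfl | rfl | rfl | he
    · exact ⟨edgeA, _, lenA'⟩
    · exact ⟨edgeB, _, lenB'⟩
    · exact ⟨edgeN, _, lenN⟩
    · obtain ⟨h1, h2, h3⟩ := hFE e he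
      refine ⟨⟨h1.1, ?_⟩, h3⟩
      have := h1.2.inter_right H
      rwa [Set.inter_eq_left.2 (hfar e h1.2 h2)] at this)
  rw [Finset.sum_insert nA, Finset.sum_insert nB, Finset.sum_insert nN, lenA'.ratLen_eq,
    lenB'.ratLen_eq, lenN.ratLen_eq] at hmain
  have hF0 : 0 ≤ ∑ e ∈ F, ratLen e := Finset.sum_nonneg fun e _ => ratLen_nonneg e
  linarith

/-- If `Δ s` is obtained from `Δ 0` by `s` corner choppings, then the rational length
of every edge of `Δ 0` is at most `2 ^ s` times the rational perimeter of `Δ s`. -/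
theorem stmt15 (s : ℕ) (Δ : ℕ → Set (Pt 2)) (δ : ℕ → ℝ)
    (hΔ : ∀ i ≤ s, IsDelzant (Δ i))
    (hchop : ∀ i < s, 0 < δ i ∧ ∃ w, IsCornerChop (Δ i) w (δ i) (Δ (i + 1)))
    (d : Set (Pt 2)) (hd : IsEdge (Δ 0) d) (ℓ P : ℝ)
    (hℓ : RatLength d ℓ) (hP : HasPerimeter (Δ s) P) :
    ℓ ≤ 2 ^ s * P := by
  have hind : ∀ k ≤ s, PerimeterLE (Δ (s - k)) (2 ^ k * P) := by
    intro k
    induction k with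
    | zero => intro _; simpa using hP.perimeterLE
    | succ k ih =>
      intro hk
      obtain ⟨-, w, hw⟩ := hchop (s - (k + 1)) (by omega)
      rw [show s - (k + 1) + 1 = s - k by omega] at hw
      have := hw.perimeterLE (hΔ _ (by omega)).1.2.1 (ih (by omega))
      rwa [← mul_assoc, ← pow_succ'] at this
  have := hind s le_rfl {d} (by simpa using ⟨hd, ℓ, hℓ⟩)
  simpa [hℓ.ratLen_eq] using this
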